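/- Assume that for each k = 1, …, K the space H_k has a Hilbert (orthonormal) basis (ψ_j^{(k)})_{j≥1} of eigenvectors of A_k, namely A_k ψ_j^{(k)} = ε_j^{(k)} ψ_j^{(k)}, with (ε_j^{(k)})_{j≥1} nondecreasing and ε_1^{(k)} > 0. Let f ∈ H, let u ∈ H solve A u = f, let u_N ∈ H be arbitrary, and set Res := f − A u_N. Then for any choice of truncation indices J_1, …, J_K ≥ 1 one has the guaranteed, practically computable bound ‖u − u_N‖_A² ≤ C · [ Σ_{k=1}^{K} ( Σ_{j=1}^{J_k} (ε_j^{(k)})⁻¹ ⟨T_k Res, ψ_j^{(k)}⟩² + (ε_{J_k}^{(k)})⁻¹ ( ‖T_k Res‖² − Σ_{j=1}^{J_k} ⟨T_k Res, ψ_j^{(k)}⟩² ) ) + ⟨T_{K+1} Res, A_{K+1}⁻¹ T_{K+1} Res⟩ ]. (This is Theorem 3.4 of the paper, the guaranteed practical estimation for the source problem.) -/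

import Mathlib

open scoped RealInnerProductSpace

/-- Weighted Young inequality for a symmetric positive operator with right inverse `B`. -/
theorem two_mul_inner_le_energy_add_dual
    {E : Type*} [NormedAddCommGroup E] [InnerProductSpace ℝ E] (A B : E →L[ℝ] E)
    (hsym : ∀ v w : E, ⟪A v, w⟫ = ⟪v, A w⟫) (hpos : ∀ w : E, 0 ≤ ⟪w, A w⟫)
    (hAB : ∀ v, A (B v) = v) (c : ℝ) (x g : E) :
    2 * c * ⟪x, g⟫ ≤ ⟪x, A x⟫ + c ^ 2 * ⟪g, B g⟫ := by
  have h := hpos (x - c • B g)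
  have hx : ⟪B g, A x⟫ = ⟪x, g⟫ := by
    rw [← hsym, hAB, real_inner_comm]
  simp only [map_sub, map_smul, hAB, inner_sub_left, inner_sub_right, inner_smul_left,
    inner_smul_right, hx, real_inner_comm g (B g), RCLike.conj_to_real] at h
  linarith

/-- Bounding the tail of the eigenvector expansion of the dual norm by the last eigenvalue kept. -/
theorem HilbertBasis.inner_inverse_le_truncation
    {E : Type*} [NormedAddCommGroup E] [InnerProductSpace ℝ E] (A B : E →L[ℝ] E)
    (hsym : ∀ v w : E, ⟪A v, w⟫ = ⟪v, A w⟫) (hAB : ∀ v, A (B v) = v)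
    (ψ : HilbertBasis ℕ ℝ E) (ε : ℕ → ℝ) (hmono : Monotone ε) (hε : 0 < ε 0)
    (hEig : ∀ j, A (ψ j) = ε j • ψ j) (n : ℕ) (g : E) :
    ⟪g, B g⟫ ≤ (∑ j ∈ Finset.range n, (ε j)⁻¹ * ⟪g, ψ j⟫ ^ 2)
      + (ε (n - 1))⁻¹ * (‖g‖ ^ 2 - ∑ j ∈ Finset.range n, ⟪g, ψ j⟫ ^ 2) := by
  have hεpos : ∀ j, 0 < ε j := fun j => hε.trans_le (hmono (Nat.zero_le j))
  have hcoef : ∀ j, ⟪ψ j, B g⟫ = (ε j)⁻¹ * ⟪g, ψ j⟫ := by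
    intro j
    have h := hsym (ψ j) (B g)
    rw [hEig, hAB, real_inner_smul_left, real_inner_comm g] at h
    rwa [eq_inv_mul_iff_mul_eq₀ (hεpos j).ne']
  have hdual : HasSum (fun j => (ε j)⁻¹ * ⟪g, ψ j⟫ ^ 2) ⟪g, B g⟫ := by
    refine (ψ.hasSum_inner_mul_inner g (B g)).congr_fun fun j => ?_
    rw [hcoef]; ring
  have hnorm : HasSum (fun j => ⟪g, ψ j⟫ ^ 2) (‖g‖ ^ 2) := by
    rw [← real_inner_self_eq_norm_sq]
    refine (ψ.hasSum_inner_mul_inner g g).congr_fun fun j => ?_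
    rw [real_inner_comm g (ψ j)]; ring
  have hdual_tail := (hasSum_nat_add_iff' n).2 hdual
  have hnorm_tail := ((hasSum_nat_add_iff' n).2 hnorm).mul_left (ε (n - 1))⁻¹
  have h := hasSum_le (fun j => mul_le_mul_of_nonneg_right
    (inv_anti₀ (hεpos (n - 1)) (hmono (show n - 1 ≤ j + n by omega)))
    (sq_nonneg ⟪g, ψ (j + n)⟫)) hdual_tail hnorm_tail
  linarith

/-- Theorem 3.4: guaranteed and practical estimation for the source problem.
For `k = 1, …, K` (indices `Fin.castSucc k`) the spaces `H_k` carry Hilbert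
bases of eigenvectors of `A_k` (indexed by `j = 0, 1, 2, …`, so the truncated
sums run over `Finset.range (J k)` and the last included eigenvalue is
`ε k (J k - 1)`), and the `(K+1)`-th term involves `A_{K+1}⁻¹` directly. -/
theorem source_problem_practical_estimate
    {H : Type*} [NormedAddCommGroup H] [InnerProductSpace ℝ H] [CompleteSpace H]
    {K : ℕ} (hK : 1 ≤ K)
    {Hk : Fin (K + 1) → Type*} [∀ k, NormedAddCommGroup (Hk k)]
    [∀ k, InnerProductSpace ℝ (Hk k)] [∀ k, CompleteSpace (Hk k)]
    (A B : H →L[ℝ] H)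
    (hAsym : ∀ v w : H, ⟪A v, w⟫ = ⟪v, A w⟫)
    (hApos : ∀ w : H, 0 ≤ ⟪w, A w⟫)
    (hAB : ∀ v, A (B v) = v) (hBA : ∀ v, B (A v) = v)
    (Ak Bk : ∀ k, Hk k →L[ℝ] Hk k)
    (hAksym : ∀ k, ∀ v w : Hk k, ⟪Ak k v, w⟫ = ⟪v, Ak k w⟫)
    (hAkpos : ∀ k, ∀ w : Hk k, 0 ≤ ⟪w, Ak k w⟫)
    (hAkBk : ∀ k, ∀ v : Hk k, Ak k (Bk k v) = v)
    (hBkAk : ∀ k, ∀ v : Hk k, Bk k (Ak k v) = v)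
    (T : ∀ k, H →L[ℝ] Hk k)
    (hT : ∀ v w : H, ⟪v, w⟫ = ∑ k, ⟪T k v, T k w⟫)
    (C : ℝ) (hC : 0 < C)
    (hCbound : ∀ w : H, ∑ k, ⟪T k w, Ak k (T k w)⟫ ≤ C * ⟪w, A w⟫)
    (ψ : ∀ k : Fin K, HilbertBasis ℕ ℝ (Hk k.castSucc))
    (ε : Fin K → ℕ → ℝ)
    (hεmono : ∀ k, Monotone (ε k)) (hεpos : ∀ k, 0 < ε k 0)
    (hEig : ∀ (k : Fin K) (j : ℕ), Ak k.castSucc (ψ k j) = ε k j • ψ k j)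
    (J : Fin K → ℕ) (hJ : ∀ k, 1 ≤ J k)
    (f u uN : H) (hu : A u = f) (Res : H) (hRes : Res = f - A uN) :
    ⟪u - uN, A (u - uN)⟫ ≤
      C * ((∑ k : Fin K,
        ((∑ j ∈ Finset.range (J k), (ε k j)⁻¹ * ⟪T k.castSucc Res, ψ k j⟫ ^ 2)
          + (ε k (J k - 1))⁻¹ * (‖T k.castSucc Res‖ ^ 2
              - ∑ j ∈ Finset.range (J k), ⟪T k.castSucc Res, ψ k j⟫ ^ 2)))
        + ⟪T (Fin.last K) Res, Bk (Fin.last K) (T (Fin.last K) Res)⟫) := by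
  have hAe : A (u - uN) = Res := by rw [map_sub, hu, hRes]
  have hyoung := Finset.sum_le_sum fun k (_ : k ∈ Finset.univ) =>
    two_mul_inner_le_energy_add_dual (Ak k) (Bk k) (hAksym k) (hAkpos k) (hAkBk k) C
      (T k (u - uN)) (T k Res)
  rw [← Finset.mul_sum, ← hT, Finset.sum_add_distrib, ← Finset.mul_sum] at hyoung
  have hbound := hCbound (u - uN)
  rw [hAe] at hbound ⊢
  have hdual : ⟪u - uN, Res⟫ ≤ C * ∑ k, ⟪T k Res, Bk k (T k Res)⟫ := by
    refine le_of_mul_le_mul_left ?_ hC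
    linarith
  refine hdual.trans (mul_le_mul_of_nonneg_left ?_ hC.le)
  rw [Fin.sum_univ_castSucc]
  gcongr with k
  exact (ψ k).inner_inverse_le_truncation (Ak k.castSucc) (Bk k.castSucc) (hAksym _)
    (hAkBk _) (ε k) (hεmono k) (hεpos k) (hEig k) (J k) (T k.castSucc Res)
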